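/- Let K be a compact metrizable group such that the center of Aut(K) — the group of continuous automorphisms of K commuting with every continuous automorphism of K — has DCC on K. Then every ergodic action of a finitely generated abelian group of continuous automorphisms of K contains an ergodic automorphism: if Γ is a finitely generated abelian group of continuous automorphisms of K which is ergodic on K, then some α ∈ Γ is ergodic on K. -/

import Mathlib

open MeasureTheory Topology Set

set_option linter.unusedVariables false

namespace ErgZd

variable {K : Type*}

/-- The group of bi-continuous automorphisms of a topological group,
as a subgroup of `MulAut K`. -/
def ContAut (K : Type*) [Group K] [TopologicalSpace K] : Subgroup (MulAut K) where
  carrier := {α | Continuous α ∧ Continuous α.symm}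
  one_mem' := ⟨continuous_id, continuous_id⟩
  mul_mem' := fun {a b} ha hb => ⟨ha.1.comp hb.1, hb.2.comp ha.2⟩
  inv_mem' := fun {a} ha => ⟨ha.2, ha.1⟩

section Defs

variable [Group K] [TopologicalSpace K]

lemma ContAut.continuous (α : ↥(ContAut K)) : Continuous ⇑(α : MulAut K) := α.2.1

lemma ContAut.continuous_symm (α : ↥(ContAut K)) :
    Continuous ⇑(α : MulAut K).symm := α.2.2

/-- Ergodicity of the action of a set `S` of automorphisms with respect to `μ`:
every invariant Borel set is null or conull. -/
def ErgSet [MeasurableSpace K] (μ : Measure K) (S : Set ↥(ContAut K)) : Prop :=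
  ∀ A : Set K, MeasurableSet A → (∀ α ∈ S, (α : MulAut K) '' A = A) → μ A = 0 ∨ μ A = 1

/-- Ergodicity of a single automorphism: ergodicity of the group of its integer powers. -/
def ErgAut [MeasurableSpace K] (μ : Measure K) (α : ↥(ContAut K)) : Prop :=
  ErgSet μ (Set.range fun n : ℤ => α ^ n)

/-- Distality of the action of a set of automorphisms: for `x ≠ 1`, the identity is
not in the closure of the orbit of `x`. -/
def DistalSet (S : Set ↥(ContAut K)) : Prop :=
  ∀ x : K, x ≠ 1 → (1 : K) ∉ closure ((fun α : ↥(ContAut K) => (α : MulAut K) x) '' S)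

/-- Distality of a single automorphism. -/
def DistalAut (α : ↥(ContAut K)) : Prop := DistalSet (Set.range fun n : ℤ => α ^ n)

/-- The descending chain condition for an action: every decreasing
sequence of closed invariant subgroups is eventually constant. -/
def HasDCC (S : Set ↥(ContAut K)) : Prop :=
  ∀ C : ℕ → Subgroup K, (∀ n, IsClosed (C n : Set K)) → (∀ n, C (n + 1) ≤ C n) →
    (∀ n, ∀ α ∈ S, ∀ x, x ∈ C n ↔ (α : MulAut K) x ∈ C n) → ∃ N, ∀ n, N ≤ n → C n = C N

/-- Restriction of an automorphism to an invariant subgroup. -/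
def restrictAut (H : Subgroup K) (α : ↥(ContAut K))
    (h : ∀ x, x ∈ H ↔ (α : MulAut K) x ∈ H) : ↥(ContAut ↥H) := by
  refine ⟨⟨⟨fun x => ⟨(α : MulAut K) x, (h x).mp x.2⟩,
      fun x => ⟨(α : MulAut K).symm x, (h _).mpr (by simpa using x.2)⟩, ?_, ?_⟩, ?_⟩, ?_, ?_⟩
  · intro x; ext; simp
  · intro x; ext; simp
  · intro x y; ext; simp
  · exact Continuous.subtype_mk ((ContAut.continuous α).comp continuous_subtype_val) _
  · exact Continuous.subtype_mk ((ContAut.continuous_symm α).comp continuous_subtype_val) _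

@[simp] lemma restrictAut_coe (H : Subgroup K) (α : ↥(ContAut K))
    (h : ∀ x, x ∈ H ↔ (α : MulAut K) x ∈ H) (x : ↥H) :
    ((((restrictAut H α h) : MulAut ↥H) x : ↥H) : K) = (α : MulAut K) (x : K) := rfl

/-- The automorphism induced on the quotient by an invariant closed normal subgroup. -/
def quotAut (N : Subgroup K) [N.Normal] (α : ↥(ContAut K))
    (h : ∀ x, x ∈ N ↔ (α : MulAut K) x ∈ N) : ↥(ContAut (K ⧸ N)) := by
  have hmap : N.map ((α : MulAut K) : K ≃* K) = N := by
    ext y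
    constructor
    · rintro ⟨x, hx, rfl⟩; exact (h x).mp hx
    · intro hy
      exact ⟨(α : MulAut K).symm y, (h _).mpr (by simpa using hy), by simp⟩
  refine ⟨QuotientGroup.congr N N ((α : MulAut K) : K ≃* K) hmap, ?_, ?_⟩
  · apply (QuotientGroup.isQuotientMap_mk N).continuous_iff.mpr
    have : ⇑(QuotientGroup.congr N N ((α : MulAut K) : K ≃* K) hmap) ∘ (QuotientGroup.mk : K → K ⧸ N)
        = (QuotientGroup.mk : K → K ⧸ N) ∘ ⇑(α : MulAut K) := by
      funext x
      exact QuotientGroup.congr_mk N N _ hmap x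
    rw [this]
    exact QuotientGroup.continuous_mk.comp (ContAut.continuous α)
  · apply (QuotientGroup.isQuotientMap_mk N).continuous_iff.mpr
    have : ⇑(QuotientGroup.congr N N ((α : MulAut K) : K ≃* K) hmap).symm ∘ (QuotientGroup.mk : K → K ⧸ N)
        = (QuotientGroup.mk : K → K ⧸ N) ∘ ⇑((α : MulAut K) : K ≃* K).symm := by
      funext x
      rfl
    rw [this]
    exact QuotientGroup.continuous_mk.comp (ContAut.continuous_symm α)

end Defs

open scoped Pointwise symmDiff

section Equicontinuity

variable [Group K] [TopologicalSpace K]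

/-- Every automorphism in `S` maps the subgroup `N` into itself. -/
def InvariantUnder (S : Set ↥(ContAut K)) (N : Subgroup K) : Prop :=
  ∀ β ∈ S, ∀ x ∈ N, (β : MulAut K) x ∈ N

/-- The automorphisms in `S` act equicontinuously at the identity modulo `N`. -/
def EquicontMod (S : Set ↥(ContAut K)) (N : Subgroup K) : Prop :=
  ∀ U ∈ 𝓝 (1 : K), ∃ V ∈ 𝓝 (1 : K), ∀ β ∈ S, ∀ v ∈ V, (β : MulAut K) v ∈ U * (N : Set K)

lemma ContAut.preimage_mem_nhds_one (β : ↥(ContAut K)) {U : Set K} (hU : U ∈ 𝓝 (1 : K)) :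
    (β : MulAut K) ⁻¹' U ∈ 𝓝 (1 : K) :=
  (ContAut.continuous β).continuousAt.preimage_mem_nhds (by simpa using hU)

lemma InvariantUnder.mono {S T : Set ↥(ContAut K)} {N : Subgroup K} (h : InvariantUnder T N)
    (hST : S ⊆ T) : InvariantUnder S N :=
  fun β hβ => h β (hST hβ)

lemma InvariantUnder.inf {S : Set ↥(ContAut K)} {M N : Subgroup K} (hM : InvariantUnder S M)
    (hN : InvariantUnder S N) : InvariantUnder S (M ⊓ N) :=
  fun β hβ x hx => ⟨hM β hβ x hx.1, hN β hβ x hx.2⟩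

lemma InvariantUnder.sup {S : Set ↥(ContAut K)} {M N : Subgroup K} [N.Normal]
    (hM : InvariantUnder S M) (hN : InvariantUnder S N) : InvariantUnder S (M ⊔ N) := by
  intro β hβ x hx
  obtain ⟨m, hm, n, hn, rfl⟩ := Subgroup.mem_sup_of_normal_right.1 hx
  rw [map_mul]
  exact Subgroup.mul_mem_sup (hM β hβ m hm) (hN β hβ n hn)

lemma InvariantUnder.biInf {ι : Type*} {S : Set ↥(ContAut K)} {N : ι → Subgroup K}
    (h : ∀ i, InvariantUnder S (N i)) (s : Finset ι) : InvariantUnder S (⨅ i ∈ s, N i) := by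
  intro β hβ x hx
  simp only [Subgroup.mem_iInf] at hx ⊢
  exact fun i hi => h i β hβ x (hx i hi)

/-- For a subgroup of automorphisms, invariance is an equivalence. -/
lemma InvariantUnder.mem_iff {S : Subgroup ↥(ContAut K)} {N : Subgroup K}
    (h : InvariantUnder (S : Set ↥(ContAut K)) N) {β : ↥(ContAut K)} (hβ : β ∈ S) (x : K) :
    x ∈ N ↔ (β : MulAut K) x ∈ N := by
  refine ⟨h β hβ x, fun hx => ?_⟩
  simpa using h β⁻¹ (S.inv_mem hβ) _ hx

namespace EquicontMod

variable {S T : Set ↥(ContAut K)} {M N : Subgroup K}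

lemma mono (h : EquicontMod T N) (hST : S ⊆ T) : EquicontMod S N := fun U hU =>
  let ⟨V, hV, hVU⟩ := h U hU
  ⟨V, hV, fun β hβ => hVU β (hST hβ)⟩

lemma mono_right (h : EquicontMod S M) (hMN : M ≤ N) : EquicontMod S N := fun U hU =>
  let ⟨V, hV, hVU⟩ := h U hU
  ⟨V, hV, fun β hβ v hv => mul_subset_mul_left hMN (hVU β hβ v hv)⟩

/-- A finite set of automorphisms acts equicontinuously. -/
lemma of_finite (hS : S.Finite) : EquicontMod S N := by
  intro U hU
  refine ⟨⋂ β ∈ S, (β : MulAut K) ⁻¹' U,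
    (Filter.biInter_mem hS).2 fun β _ => ContAut.preimage_mem_nhds_one β hU, ?_⟩
  intro β hβ v hv
  exact ⟨_, mem_iInter₂.1 hv β hβ, 1, N.one_mem, mul_one _⟩

lemma mul (hN : InvariantUnder S N) (hS : EquicontMod S N) (hT : EquicontMod T N) :
    EquicontMod (S * T) N := by
  intro U hU
  obtain ⟨V, hV, hVU⟩ := hS U hU
  obtain ⟨W, hW, hWV⟩ := hT V hV
  refine ⟨W, hW, ?_⟩
  rintro _ ⟨β, hβ, γ, hγ, rfl⟩ w hw
  obtain ⟨v, hv, n, hn, hvn⟩ := hWV γ hγ w hw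
  obtain ⟨u, hu, m, hm, hum⟩ := hVU β hβ v hv
  refine ⟨u, hu, m * (β : MulAut K) n, N.mul_mem hm (hN β hβ n hn), ?_⟩
  simp only [Subgroup.coe_mul, MulAut.mul_apply] at hvn hum ⊢
  rw [← hvn, map_mul, ← hum, mul_assoc]

end EquicontMod

end Equicontinuity

section Stabilizer

variable [Group K] [TopologicalSpace K] {G : Type*} [CommGroup G]

/-- The elements of `G` whose powers act equicontinuously modulo an invariant subgroup `N`. -/
def equicontSubgroup (φ : G →* ↥(ContAut K)) (N : Subgroup K)
    (hN : InvariantUnder (φ.range : Set ↥(ContAut K)) N) : Subgroup G where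
  carrier := {g | EquicontMod (Subgroup.zpowers (φ g) : Set ↥(ContAut K)) N}
  one_mem' := EquicontMod.of_finite (by simp)
  mul_mem' := by
    intro a b ha hb
    have hinv : InvariantUnder (Subgroup.zpowers (φ a) : Set ↥(ContAut K)) N :=
      hN.mono (Subgroup.zpowers_le.2 ⟨a, rfl⟩)
    refine (EquicontMod.mul hinv ha hb).mono ?_
    rintro _ ⟨n, rfl⟩
    refine ⟨φ a ^ n, ⟨n, rfl⟩, φ b ^ n, ⟨n, rfl⟩, ?_⟩
    simp only [← map_zpow, ← map_mul, mul_zpow]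
  inv_mem' := by
    intro a ha
    simpa using ha

variable {φ : G →* ↥(ContAut K)} {N : Subgroup K}
  {hN : InvariantUnder (φ.range : Set ↥(ContAut K)) N}

lemma mem_equicontSubgroup {g : G} : g ∈ equicontSubgroup φ N hN ↔
    EquicontMod (Subgroup.zpowers (φ g) : Set ↥(ContAut K)) N := Iff.rfl

/-- `equicontSubgroup` is closed under taking roots. -/
lemma mem_equicontSubgroup_of_pow_mem {g : G} {n : ℕ} (hn : n ≠ 0)
    (h : g ^ n ∈ equicontSubgroup φ N hN) : g ∈ equicontSubgroup φ N hN := by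
  rw [mem_equicontSubgroup] at h ⊢
  have hfin : ((fun j : ℕ => φ g ^ j) '' (Finset.range n : Set ℕ)).Finite :=
    (Finset.finite_toSet _).image _
  have hinv : InvariantUnder ((fun j : ℕ => φ g ^ j) '' (Finset.range n : Set ℕ)) N := by
    refine hN.mono ?_
    rintro _ ⟨j, -, rfl⟩
    exact ⟨g ^ j, map_pow _ _ _⟩
  refine (EquicontMod.mul hinv (.of_finite hfin) h).mono ?_
  rintro _ ⟨m, rfl⟩
  have hn' : (n : ℤ) ≠ 0 := by exact_mod_cast hn
  refine ⟨φ g ^ (m % n).toNat, ⟨(m % n).toNat, ?_, rfl⟩, φ (g ^ n) ^ (m / n), ⟨_, rfl⟩, ?_⟩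
  · have := Int.emod_lt_of_pos m (b := n) (by omega)
    simp only [Finset.coe_range, mem_Iio]
    omega
  · have h1 : φ g ^ (m % n).toNat = φ g ^ (m % n) := by
      rw [← zpow_natCast, Int.toNat_of_nonneg (Int.emod_nonneg m hn')]
    simp only [h1, map_pow]
    rw [← zpow_natCast, ← zpow_mul, ← zpow_add, Int.emod_add_mul_ediv]

lemma not_finiteIndex_equicontSubgroup (h : equicontSubgroup φ N hN ≠ ⊤) :
    ¬ (equicontSubgroup φ N hN).FiniteIndex := by
  intro hfi
  refine h (eq_top_iff.2 fun g _ => ?_)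
  exact mem_equicontSubgroup_of_pow_mem hfi.index_ne_zero (Subgroup.pow_index_mem _ g)

/-- Every finitely generated subgroup of `equicontSubgroup` acts equicontinuously. -/
lemma equicontMod_closure (s : Finset G) (hs : ∀ g ∈ s, g ∈ equicontSubgroup φ N hN) :
    EquicontMod (φ '' (Subgroup.closure (s : Set G) : Set G)) N := by
  classical
  induction s using Finset.induction_on with
  | empty => exact .of_finite (by simp)
  | insert a s ha ih =>
    have hinv : InvariantUnder (Subgroup.zpowers (φ a) : Set ↥(ContAut K)) N :=
      hN.mono (Subgroup.zpowers_le.2 ⟨a, rfl⟩)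
    refine (EquicontMod.mul hinv (hs a (Finset.mem_insert_self a s))
      (ih fun g hg => hs g (Finset.mem_insert_of_mem hg))).mono ?_
    rintro _ ⟨x, hx, rfl⟩
    rw [Finset.coe_insert, Set.insert_eq, Subgroup.closure_union, SetLike.mem_coe,
      Subgroup.mem_sup] at hx
    obtain ⟨y, hy, z, hz, rfl⟩ := hx
    obtain ⟨k, rfl⟩ := Subgroup.mem_closure_singleton.1 hy
    exact ⟨φ a ^ k, ⟨k, rfl⟩, φ z, ⟨z, hz, rfl⟩, by simp⟩

lemma equicontMod_range [Group.FG G] (h : equicontSubgroup φ N hN = ⊤) :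
    EquicontMod (φ.range : Set ↥(ContAut K)) N := by
  obtain ⟨s, hs⟩ := Group.fg_def.1 ‹Group.FG G›
  have := equicontMod_closure (hN := hN) s fun g _ => h ▸ Subgroup.mem_top g
  rw [hs] at this
  simpa using this

end Stabilizer

section Compact

variable [Group K] [TopologicalSpace K] [IsTopologicalGroup K] [CompactSpace K]

/-- If `P N = K` for closed subgroups of a compact group, then `P → K / N` is open at `1`. -/
lemma inter_mul_mem_nhds_one [T2Space K] {P N : Subgroup K} [N.Normal]
    (hP : IsClosed (P : Set K)) (hN : IsClosed (N : Set K)) (hPN : P ⊔ N = ⊤) {W : Set K}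
    (hW : W ∈ 𝓝 (1 : K)) : (W ∩ (P : Set K)) * (N : Set K) ∈ 𝓝 (1 : K) := by
  set C : Set K := (P : Set K) \ (interior W * ((P ⊓ N : Subgroup K) : Set K))
  have hCc : IsCompact C :=
    hP.isCompact.diff (isOpen_interior.mul_right)
  have hcl : IsClosed (C * (N : Set K)) := (hCc.mul hN.isCompact).isClosed
  have h1 : (1 : K) ∉ C * (N : Set K) := by
    rintro ⟨p, hp, n, hn, hpn⟩
    refine hp.2 ⟨1, mem_interior_iff_mem_nhds.2 hW, p, ⟨hp.1, ?_⟩, one_mul _⟩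
    have : p = n⁻¹ := eq_inv_of_mul_eq_one_left hpn
    rw [this]
    exact N.inv_mem hn
  filter_upwards [hcl.isOpen_compl.mem_nhds h1] with x hx
  obtain ⟨p, hp, n, hn, rfl⟩ :=
    Subgroup.mem_sup_of_normal_right.1 (hPN ▸ Subgroup.mem_top x)
  have hpC : p ∉ C := fun h => hx ⟨p, h, n, hn, rfl⟩
  obtain ⟨w, hw, m, hm, rfl⟩ : p ∈ interior W * ((P ⊓ N : Subgroup K) : Set K) := by
    by_contra h
    exact hpC ⟨hp, h⟩
  refine ⟨w, ⟨interior_subset hw, ?_⟩, m * n, N.mul_mem hm.2 hn, (mul_assoc _ _ _).symm⟩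
  exact (P.mul_mem_cancel_right hm.1).1 hp

/-- Equicontinuity modulo `N` passes to `M (N ∩ P)` when `P` is invariant and a supplement of
both `N` and `M`. -/
lemma EquicontMod.sup_inf [T2Space K] {S : Set ↥(ContAut K)} {M N P : Subgroup K}
    [M.Normal] [N.Normal] [P.Normal] (hM : IsClosed (M : Set K)) (hN : IsClosed (N : Set K))
    (hP : IsClosed (P : Set K)) (hMS : InvariantUnder S M) (hPS : InvariantUnder S P)
    (hPM : P ⊔ M = ⊤) (hPN : P ⊔ N = ⊤) (h : EquicontMod S N) :
    EquicontMod S ((N ⊓ P) ⊔ M) := by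
  intro U hU
  have hnhds := inter_mul_mem_nhds_one hP hN hPN hU
  obtain ⟨V, hV, hVU⟩ := h _ hnhds
  refine ⟨_, inter_mul_mem_nhds_one hP hM hPM hV, ?_⟩
  rintro β hβ _ ⟨p, ⟨hpV, hpP⟩, m, hm, rfl⟩
  obtain ⟨_, ⟨u, hu, n, hn, rfl⟩, n', hn', hβp⟩ := hVU β hβ p hpV
  refine ⟨u, hu.1, n * n' * (β : MulAut K) m, ?_, ?_⟩
  · refine Subgroup.mul_mem_sup ⟨N.mul_mem hn hn', ?_⟩ (hMS β hβ m hm)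
    have : n * n' = u⁻¹ * (β : MulAut K) p := by
      rw [← hβp]
      group
    rw [this]
    exact P.mul_mem (P.inv_mem hu.2) (hPS β hβ p hpP)
  · simp only [map_mul, ← hβp, mul_assoc]

/-- An ergodic group of automorphisms is not equicontinuous modulo a proper closed invariant
subgroup. -/
lemma not_equicontMod_of_ergSet [T2Space K] [MeasurableSpace K] [BorelSpace K] (μ : Measure K)
    [μ.IsOpenPosMeasure] [IsProbabilityMeasure μ] {S : Subgroup ↥(ContAut K)} {N : Subgroup K}
    (hS : ErgSet μ (S : Set ↥(ContAut K))) (hN : IsClosed (N : Set K)) (htop : N ≠ ⊤)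
    (hinv : InvariantUnder (S : Set ↥(ContAut K)) N) :
    ¬ EquicontMod (S : Set ↥(ContAut K)) N := by
  intro hE
  obtain ⟨y, hy⟩ : ∃ y, y ∉ N := by
    by_contra! h
    exact htop (eq_top_iff.2 fun x _ => h x)
  have hyN : {u : K | u⁻¹ * y ∈ (N : Set K)ᶜ} ∈ 𝓝 (1 : K) :=
    (hN.isOpen_compl.preimage (by fun_prop)).mem_nhds (by simpa using hy)
  obtain ⟨U, hU, hUcl, hUy⟩ := exists_mem_nhds_isClosed_subset hyN
  obtain ⟨V, hV, hVU⟩ := hE U hU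
  set W : Set K := ⋃ β ∈ S, (β : MulAut K) '' interior V
  have hWopen : IsOpen W := by
    refine isOpen_biUnion fun β _ => ?_
    have : (β : MulAut K) '' interior V = (β : MulAut K).symm ⁻¹' interior V :=
      (β : MulAut K).toEquiv.image_eq_preimage_symm _
    rw [this]
    exact isOpen_interior.preimage (ContAut.continuous_symm β)
  have hWU : W ⊆ U * (N : Set K) := by
    refine iUnion₂_subset fun β hβ => ?_
    rintro _ ⟨v, hv, rfl⟩
    exact hVU β hβ v (interior_subset hv)
  have hW1 : (1 : K) ∈ W :=
    mem_iUnion₂.2 ⟨1, S.one_mem, 1, mem_interior_iff_mem_nhds.2 hV, rfl⟩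
  have hWsub : ∀ α ∈ S, (α : MulAut K) '' W ⊆ W := by
    rintro α hα _ ⟨x, hx, rfl⟩
    obtain ⟨β, hβ, v, hv, rfl⟩ := mem_iUnion₂.1 hx
    exact mem_iUnion₂.2 ⟨α * β, S.mul_mem hα hβ, v, hv, rfl⟩
  have hWinv : ∀ α ∈ (S : Set ↥(ContAut K)), (α : MulAut K) '' W = W := by
    intro α hα
    refine (hWsub α hα).antisymm fun x hx => ?_
    exact ⟨_, hWsub α⁻¹ (S.inv_mem hα) ⟨x, hx, rfl⟩, by simp⟩
  rcases hS W hWopen.measurableSet hWinv with h0 | h1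
  · exact (hWopen.measure_pos μ ⟨1, hW1⟩).ne' h0
  · have hcl : IsClosed (U * (N : Set K)) := (hUcl.isCompact.mul hN.isCompact).isClosed
    have hyU : y ∈ (U * (N : Set K))ᶜ := by
      rintro ⟨u, hu, n, hn, hun⟩
      refine hUy hu ?_
      simpa [← hun] using hn
    have hpos := hcl.isOpen_compl.measure_pos μ ⟨y, hyU⟩
    have : μ (U * (N : Set K))ᶜ = 0 := by
      refine measure_mono_null (compl_subset_compl.2 hWU) ?_
      exact (prob_compl_eq_zero_iff hWopen.measurableSet).2 h1
    exact hpos.ne' this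

end Compact

section Haar

/-- The measure of the symmetric difference of `A` and its left translate by `k⁻¹`. -/
noncomputable def shiftDist [Group K] [MeasurableSpace K] (μ : Measure K) (A : Set K) (k : K) :
    ℝ :=
  μ.real (((k * ·) ⁻¹' A) ∆ A)

lemma shiftDist_nonneg [Group K] [MeasurableSpace K] (μ : Measure K) (A : Set K) (k : K) :
    0 ≤ shiftDist μ A k := measureReal_nonneg

lemma shiftDist_one [Group K] [MeasurableSpace K] (μ : Measure K) (A : Set K) :
    shiftDist μ A 1 = 0 := by
  simp [shiftDist]

variable [Group K] [TopologicalSpace K] [IsTopologicalGroup K] [MeasurableSpace K] [BorelSpace K]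

lemma shiftDist_inv {μ : Measure K} [μ.IsHaarMeasure] {A : Set K} (hA : MeasurableSet A) (k : K) :
    shiftDist μ A k⁻¹ = shiftDist μ A k := by
  have := (measurePreserving_mul_left μ k).measureReal_preimage
      (((measurable_const_mul k⁻¹ hA).symmDiff hA).nullMeasurableSet)
  rw [shiftDist, ← this, preimage_symmDiff, preimage_preimage, symmDiff_comm, shiftDist]
  simp

lemma shiftDist_mul_le {μ : Measure K} [μ.IsHaarMeasure] [IsFiniteMeasure μ] {A : Set K}
    (hA : MeasurableSet A) (k l : K) :
    shiftDist μ A (k * l) ≤ shiftDist μ A k + shiftDist μ A l := by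
  have h : shiftDist μ A k = μ.real (((k * l * ·) ⁻¹' A) ∆ ((l * ·) ⁻¹' A)) := by
    have := (measurePreserving_mul_left μ l).measureReal_preimage
      (((measurable_const_mul k hA).symmDiff hA).nullMeasurableSet)
    rw [shiftDist, ← this, preimage_symmDiff, preimage_preimage]
    simp only [mul_assoc]
  rw [h]
  exact measureReal_symmDiff_le (μ := μ) (s := (k * l * ·) ⁻¹' A) (t := (l * ·) ⁻¹' A) A

variable (μ : Measure K) [μ.IsHaarMeasure] [IsProbabilityMeasure μ]

/-- The measurable sets invariant under every automorphism in `S`. -/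
def invariantSets (S : Set ↥(ContAut K)) : Set (Set K) :=
  {A | MeasurableSet A ∧ ∀ β ∈ S, ⇑(β : MulAut K) ⁻¹' A = A}

/-- The normal core of the common stabilizer, modulo null sets, of all `S`-invariant sets. -/
def invariantKernel (S : Set ↥(ContAut K)) : Subgroup K where
  carrier := {k | ∀ A ∈ invariantSets S, ∀ h, shiftDist μ A (h * k * h⁻¹) = 0}
  one_mem' := fun A _ h => by simp [shiftDist_one]
  mul_mem' := by
    intro a b ha hb A hA h
    refine le_antisymm ?_ (shiftDist_nonneg μ A _)
    have := shiftDist_mul_le (μ := μ) hA.1 (h * a * h⁻¹) (h * b * h⁻¹)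
    rw [ha A hA h, hb A hA h, add_zero] at this
    simpa [mul_assoc] using this
  inv_mem' := by
    intro a ha A hA h
    have := ha A hA h
    rw [← shiftDist_inv hA.1] at this
    simpa [mul_assoc] using this

instance (S : Set ↥(ContAut K)) : (invariantKernel μ S).Normal where
  conj_mem k hk g A hA h := by
    simpa [mul_assoc] using hk A hA (h * g)

/-- The elements all of whose conjugates move `A` by at most `ε`. -/
def conjBall (A : Set K) (ε : ℝ) : Set K :=
  {k | ∀ h, shiftDist μ A (h * k * h⁻¹) ≤ ε}

lemma invariantKernel_eq_iInter (S : Set ↥(ContAut K)) : (invariantKernel μ S : Set K) =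
    ⋂ p : invariantSets S × Ioi (0 : ℝ), conjBall μ p.1 p.2 := by
  ext k
  simp only [mem_iInter]
  constructor
  · rintro hk ⟨A, ε⟩ h
    rw [hk A A.2 h]
    exact le_of_lt ε.2
  · intro hk A hA h
    refine le_antisymm (le_of_forall_pos_le_add fun ε hε => ?_) (shiftDist_nonneg μ A _)
    simpa using hk ⟨⟨A, hA⟩, ⟨ε, hε⟩⟩ h

variable [CompactSpace K]

/-- Continuous automorphisms of a compact group preserve the Haar measure. -/
lemma ContAut.measurePreserving (β : ↥(ContAut K)) :
    MeasurePreserving ⇑(β : MulAut K) μ μ := by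
  refine ⟨(ContAut.continuous β).measurable, ?_⟩
  have h := MulEquiv.isHaarMeasure_map μ (β : MulAut K) (ContAut.continuous β)
    (ContAut.continuous_symm β)
  have hp : IsProbabilityMeasure (μ.map ⇑(β : MulAut K)) :=
    Measure.isProbabilityMeasure_map (ContAut.continuous β).aemeasurable
  exact Measure.isHaarMeasure_eq_of_isProbabilityMeasure _ _

variable {μ}

lemma shiftDist_apply {A : Set K} (hA : MeasurableSet A) (β : ↥(ContAut K)) (k : K) :
    shiftDist μ A ((β : MulAut K) k) = shiftDist μ (⇑(β : MulAut K) ⁻¹' A) k := by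
  have := (ContAut.measurePreserving μ β).measureReal_preimage
      (((measurable_const_mul ((β : MulAut K) k) hA).symmDiff hA).nullMeasurableSet)
  rw [shiftDist, ← this, preimage_symmDiff, preimage_preimage, shiftDist, preimage_preimage]
  simp only [map_mul]

lemma continuous_shiftDist [TopologicalSpace.MetrizableSpace K] {A : Set K}
    (hA : MeasurableSet A) : Continuous (shiftDist μ A) := by
  have h1 : Filter.Tendsto (shiftDist μ A) (𝓝 1) (𝓝 0) := by
    let f : C(K, C(K, K)) := ContinuousMap.curry ⟨fun p : K × K => p.1 * p.2, continuous_mul⟩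
    have hf : ∀ k, MeasurePreserving (f k) μ μ := fun k => measurePreserving_mul_left μ k
    have := tendsto_measure_symmDiff_preimage_nhds_zero (f.continuous.tendsto 1)
      (.of_forall hf) (hf 1) hA.nullMeasurableSet (measure_ne_top μ A)
    have h := (ENNReal.tendsto_toReal ENNReal.zero_ne_top).comp this
    simp only [ENNReal.toReal_zero] at h
    have hf1 : ⇑(f 1) ⁻¹' A = A := by
      ext x
      exact iff_of_eq (congrArg (· ∈ A) (one_mul x))
    rw [hf1] at h
    exact h
  rw [continuous_iff_continuousAt]
  intro z
  have h2 : Filter.Tendsto (fun w => shiftDist μ A (w * z⁻¹)) (𝓝 z) (𝓝 0) :=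
    h1.comp (((continuous_mul_const z⁻¹).tendsto z).trans (by simp))
  rw [ContinuousAt, tendsto_iff_dist_tendsto_zero]
  refine squeeze_zero (fun _ => dist_nonneg) (fun w => ?_) h2
  rw [Real.dist_eq, abs_sub_le_iff]
  have e1 := shiftDist_mul_le (μ := μ) hA (w * z⁻¹) z
  have e2 := shiftDist_mul_le (μ := μ) hA (w * z⁻¹)⁻¹ w
  rw [shiftDist_inv hA] at e2
  simp only [mul_inv_rev, inv_inv, mul_assoc, inv_mul_cancel, mul_one]
    at e1 e2
  constructor <;> linarith

lemma measure_eq_zero_or_one_of_shiftDist [TopologicalSpace.MetrizableSpace K] {A : Set K}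
    (hA : MeasurableSet A) (h : ∀ k, shiftDist μ A k = 0) : μ A = 0 ∨ μ A = 1 := by
  have hae : ∀ k : K, (k • ·) ⁻¹' A =ᵐ[μ] A := fun k =>
    measure_symmDiff_eq_zero_iff.1 ((measureReal_eq_zero_iff).1 (h k))
  have := aeconst_of_forall_preimage_smul_ae_eq K hA.nullMeasurableSet hae
  rcases Filter.eventuallyConst_set'.1 this with h0 | h1
  · left
    simpa using measure_congr h0
  · right
    simpa using measure_congr h1

variable (μ) (S : Set ↥(ContAut K))

lemma apply_mem_conjBall {A : Set K} (hA : A ∈ invariantSets S) {β : ↥(ContAut K)} (hβ : β ∈ S)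
    {ε : ℝ} {k : K} (hk : k ∈ conjBall μ A ε) : (β : MulAut K) k ∈ conjBall μ A ε := by
  intro h
  have := hk ((β : MulAut K).symm h)
  rw [← hA.2 β hβ, ← shiftDist_apply hA.1] at this
  simpa using this

lemma invariantUnder_invariantKernel :
    InvariantUnder (Subgroup.centralizer S : Set ↥(ContAut K)) (invariantKernel μ S) := by
  intro β hβ k hk A hA h
  have hβA : ⇑(β : MulAut K) ⁻¹' A ∈ invariantSets S := by
    refine ⟨(ContAut.continuous β).measurable hA.1, fun γ hγ => ?_⟩
    have hcomm : ∀ x, (β : MulAut K) ((γ : MulAut K) x) = (γ : MulAut K) ((β : MulAut K) x) := by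
      intro x
      have := Subgroup.mem_centralizer_iff.1 hβ γ hγ
      exact (congrArg (fun δ : ↥(ContAut K) => (δ : MulAut K) x) this).symm
    conv_rhs => rw [← hA.2 γ hγ]
    ext x
    simp [hcomm]
  have := hk _ hβA ((β : MulAut K).symm h)
  rw [← shiftDist_apply hA.1] at this
  simpa using this

variable [TopologicalSpace.MetrizableSpace K]

lemma isClosed_conjBall {A : Set K} (hA : MeasurableSet A) (ε : ℝ) :
    IsClosed (conjBall μ A ε) := by
  have : conjBall μ A ε = ⋂ h, {k | shiftDist μ A (h * k * h⁻¹) ≤ ε} := by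
    ext; simp [conjBall]
  rw [this]
  exact isClosed_iInter fun h =>
    isClosed_le ((continuous_shiftDist hA).comp (by fun_prop)) continuous_const

lemma conjBall_mem_nhds_one {A : Set K} (hA : MeasurableSet A) {ε : ℝ} (hε : 0 < ε) :
    conjBall μ A ε ∈ 𝓝 (1 : K) := by
  have hc : Continuous fun p : K × K => shiftDist μ A (p.2 * p.1 * p.2⁻¹) :=
    (continuous_shiftDist hA).comp (by fun_prop)
  have := isCompact_univ.eventually_forall_of_forall_eventually (x₀ := (1 : K))
    (P := fun k h : K => shiftDist μ A (h * k * h⁻¹) ≤ ε) fun h _ => by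
      have hlt : shiftDist μ A (h * 1 * h⁻¹) < ε := by simpa [shiftDist_one] using hε
      filter_upwards [hc.continuousAt.preimage_mem_nhds (x := ((1 : K), h)) (Iio_mem_nhds hlt)]
        with p hp using le_of_lt hp
  filter_upwards [this] with k hk h using hk h (mem_univ h)

lemma isClosed_invariantKernel : IsClosed (invariantKernel μ S : Set K) := by
  rw [invariantKernel_eq_iInter]
  exact isClosed_iInter fun p => isClosed_conjBall μ p.1.2.1 _

lemma equicontMod_invariantKernel : EquicontMod S (invariantKernel μ S) := by
  intro U hU
  have hO : IsOpen (interior U * (invariantKernel μ S : Set K)) := isOpen_interior.mul_right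
  have hsub : (invariantKernel μ S : Set K) ⊆ interior U * (invariantKernel μ S : Set K) :=
    fun k hk => ⟨1, mem_interior_iff_mem_nhds.2 hU, k, hk, one_mul k⟩
  obtain ⟨t, ht⟩ := hO.isClosed_compl.isCompact.elim_finite_subfamily_closed
    (fun p : invariantSets S × Ioi (0 : ℝ) => conjBall μ p.1 p.2)
    (fun p => isClosed_conjBall μ p.1.2.1 _) (by
      rw [← invariantKernel_eq_iInter, ← disjoint_iff_inter_eq_empty]
      exact disjoint_compl_left_iff_subset.2 hsub)
  refine ⟨⋂ p ∈ t, conjBall μ p.1 p.2, (Filter.biInter_finset_mem t).2 fun p _ =>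
    conjBall_mem_nhds_one μ p.1.2.1 p.2.2, fun β hβ v hv => ?_⟩
  refine mul_subset_mul_right interior_subset ?_
  by_contra hn
  refine (ht ▸ ?_ : (β : MulAut K) v ∈ (∅ : Set K))
  refine ⟨hn, mem_iInter₂.2 fun p hp => ?_⟩
  exact apply_mem_conjBall μ S p.1.2 hβ (mem_iInter₂.1 hv p hp)

lemma invariantKernel_ne_top (hS : ¬ ErgSet μ S) : invariantKernel μ S ≠ ⊤ := by
  intro htop
  refine hS fun A hA hinv => measure_eq_zero_or_one_of_shiftDist hA fun k => ?_
  have hAS : A ∈ invariantSets S := by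
    refine ⟨hA, fun β hβ => ?_⟩
    conv_lhs => rw [← hinv β hβ]
    exact preimage_image_eq _ (β : MulAut K).injective
  have hk : k ∈ invariantKernel μ S := htop ▸ Subgroup.mem_top k
  simpa using hk A hAS 1

end Haar

section Main

variable [Group K] [TopologicalSpace K] [IsTopologicalGroup K] [CompactSpace K]

/-- Proper closed normal subgroups invariant under every automorphism in `S`. -/
structure IsProperFactor (S : Set ↥(ContAut K)) (N : Subgroup K) : Prop where
  isClosed : IsClosed (N : Set K)
  normal : N.Normal
  ne_top : N ≠ ⊤
  invariant : InvariantUnder S N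

/-- Invariant normal subgroups with distinct maximal equicontinuity groups are independent. -/
lemma sup_biInf_eq_top [T2Space K] {G ι : Type*} [CommGroup G] {φ : G →* ↥(ContAut K)}
    {S : Set ↥(ContAut K)} (hφ : (φ.range : Set ↥(ContAut K)) ⊆ S) {N : ι → Subgroup K}
    (hN : ∀ i, IsProperFactor S (N i))
    (hmax : ∀ i M (hM : IsProperFactor S M),
      equicontSubgroup φ (N i) ((hN i).invariant.mono hφ) ≤
        equicontSubgroup φ M (hM.invariant.mono hφ) →
      equicontSubgroup φ M (hM.invariant.mono hφ) ≤
        equicontSubgroup φ (N i) ((hN i).invariant.mono hφ))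
    (hinj : ∀ i j, equicontSubgroup φ (N i) ((hN i).invariant.mono hφ) ≤
        equicontSubgroup φ (N j) ((hN j).invariant.mono hφ) → i = j)
    (s : Finset ι) : ∀ k ∉ s, (⨅ i ∈ s, N i) ⊔ N k = ⊤ := by
  classical
  have hnormal : ∀ i, (N i).Normal := fun i => (hN i).normal
  induction s using Finset.induction_on with
  | empty => simp
  | insert j s hj ih =>
    intro k hk
    rw [Finset.mem_insert, not_or] at hk
    rw [Finset.iInf_insert]
    set P := ⨅ i ∈ s, N i with hP
    have hPn : P.Normal := Subgroup.normal_iInf_normal fun i =>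
      Subgroup.normal_iInf_normal fun _ => hnormal i
    have hPc : IsClosed (P : Set K) := by
      simp only [hP, Subgroup.coe_iInf]
      exact isClosed_biInter fun i _ => (hN i).isClosed
    have hPi : InvariantUnder S P := .biInf (fun i => (hN i).invariant) s
    by_contra htop
    have hM : IsProperFactor S ((N j ⊓ P) ⊔ N k) :=
      { isClosed := by
          rw [Subgroup.mul_normal]
          exact (((hN j).isClosed.inter hPc).isCompact.mul (hN k).isClosed.isCompact).isClosed
        normal := inferInstance
        ne_top := htop
        invariant := ((hN j).invariant.inf hPi).sup (hN k).invariant }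
    have hle := hmax k _ hM fun g hg => EquicontMod.mono_right hg le_sup_right
    refine hk.1 (hinj j k (le_trans (fun g hg => ?_) hle)).symm
    have hz : (Subgroup.zpowers (φ g) : Set ↥(ContAut K)) ⊆ S :=
      Subset.trans (Subgroup.zpowers_le.2 ⟨g, rfl⟩ : Subgroup.zpowers (φ g) ≤ φ.range) hφ
    exact EquicontMod.sup_inf (hN k).isClosed (hN j).isClosed hPc ((hN k).invariant.mono hz)
      (hPi.mono hz) (ih k hk.2) (ih j hj) hg

/-- The lattice of subgroups of a finitely generated abelian group satisfies the ascending chain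
condition. -/
lemma wellFoundedGT_subgroup (G : Type*) [CommGroup G] [Group.FG G] :
    WellFoundedGT (Subgroup G) := by
  have : Module.Finite ℤ (Additive G) := Module.Finite.iff_addGroup_fg.2 inferInstance
  have : IsNoetherian ℤ (Additive G) := inferInstance
  exact (Subgroup.toAddSubgroup.trans AddSubgroup.toIntSubmodule).strictMono.wellFoundedGT

/-- An ergodic action of a finitely generated abelian group contains an ergodic automorphism when
the center of the automorphism group has the descending chain condition. -/
theorem exists_ergAut_of_ergSet_range [TopologicalSpace.MetrizableSpace K] [MeasurableSpace K]
    [BorelSpace K] (μ : Measure K) [μ.IsHaarMeasure] [IsProbabilityMeasure μ]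
    (hdcc : HasDCC {β : ↥(ContAut K) | ∀ γ : ↥(ContAut K), β * γ = γ * β})
    {G : Type*} [CommGroup G] [Group.FG G] (φ : G →* ↥(ContAut K))
    (herg : ErgSet μ (φ.range : Set ↥(ContAut K))) : ∃ g, ErgAut μ (φ g) := by
  classical
  have := wellFoundedGT_subgroup G
  set S : Subgroup ↥(ContAut K) := Subgroup.centralizer (φ.range : Set ↥(ContAut K))
  have hφ : (φ.range : Set ↥(ContAut K)) ⊆ S := by
    rintro _ ⟨a, rfl⟩
    refine Subgroup.mem_centralizer_iff.2 ?_
    rintro _ ⟨b, rfl⟩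
    rw [← map_mul, ← map_mul, mul_comm]
  let E : {N : Subgroup K // IsProperFactor (S : Set ↥(ContAut K)) N} → Subgroup G :=
    fun N => equicontSubgroup φ N.1 (N.2.invariant.mono hφ)
  have hE : ∀ N, ¬ (E N).FiniteIndex := fun N => not_finiteIndex_equicontSubgroup fun htop =>
    not_equicontMod_of_ergSet μ herg N.2.isClosed N.2.ne_top (N.2.invariant.mono hφ)
      (equicontMod_range htop)
  by_contra! hne
  have hcover : ∀ g : G, ∃ Λ, Maximal (· ∈ range E) Λ ∧ g ∈ Λ := by
    intro g
    have hz : (Subgroup.zpowers (φ g) : Set ↥(ContAut K)) ⊆ φ.range :=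
      (Subgroup.zpowers_le.2 ⟨g, rfl⟩ : Subgroup.zpowers (φ g) ≤ φ.range)
    have hN : IsProperFactor (S : Set ↥(ContAut K))
        (invariantKernel μ (Subgroup.zpowers (φ g) : Set ↥(ContAut K))) :=
      { isClosed := isClosed_invariantKernel μ _
        normal := inferInstance
        ne_top := invariantKernel_ne_top μ _ (hne g)
        invariant := (invariantUnder_invariantKernel μ _).mono (Subgroup.centralizer_le hz) }
    obtain ⟨Λ, hle, hΛ⟩ := exists_maximal_ge_of_wellFoundedGT (· ∈ range E) (E ⟨_, hN⟩) ⟨_, rfl⟩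
    exact ⟨Λ, hΛ, hle (equicontMod_invariantKernel μ _)⟩
  rcases Set.finite_or_infinite {Λ | Maximal (· ∈ range E) Λ} with hfin | hinf
  · have hun : ⋃ Λ ∈ hfin.toFinset, (1 : G) • ((id Λ : Subgroup G) : Set G) = univ := by
      refine eq_univ_of_forall fun g => ?_
      obtain ⟨Λ, hΛ, hg⟩ := hcover g
      exact mem_iUnion₂.2 ⟨Λ, hfin.mem_toFinset.2 hΛ, by simpa using hg⟩
    obtain ⟨Λ, hΛ, hfi⟩ := Subgroup.exists_finiteIndex_of_leftCoset_cover hun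
    obtain ⟨N, rfl⟩ := (hfin.mem_toFinset.1 hΛ).1
    exact hE N hfi
  · let f := hinf.natEmbedding
    choose N hN using fun i => (f i).2.1
    have hmaxN : ∀ i, Maximal (· ∈ range E) (E (N i)) := fun i => (hN i) ▸ (f i).2
    have hsup := sup_biInf_eq_top (φ := φ) hφ (N := fun i => (N i).1) (fun i => (N i).2)
      (fun i M hM hle => (hmaxN i).2 ⟨⟨M, hM⟩, rfl⟩ hle) (by
        intro i j hle
        refine f.injective (Subtype.ext ?_)
        rw [← hN i, ← hN j]
        exact le_antisymm hle ((hmaxN i).2 ⟨_, rfl⟩ hle))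
    obtain ⟨m, hm⟩ := hdcc (fun m => ⨅ i ∈ Finset.range m, (N i).1)
      (fun m => by
        simp only [Subgroup.coe_iInf]
        exact isClosed_biInter fun i _ => (N i).2.isClosed)
      (fun m => biInf_mono fun i hi => Finset.range_subset_range.2 m.le_succ hi)
      (fun m β hβ x => (InvariantUnder.biInf (fun i => (N i).2.invariant) _).mem_iff
        (Subgroup.mem_centralizer_iff.2 fun γ _ => (hβ γ).symm) x)
    have hle : (⨅ i ∈ Finset.range m, (N i).1) ≤ (N m).1 := by
      rw [← hm (m + 1) m.le_succ]
      exact biInf_le (fun i => (N i).1) (Finset.self_mem_range_succ m)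
    refine (N m).2.ne_top ?_
    rw [← hsup (Finset.range m) m Finset.notMem_range_self]
    exact (sup_eq_right.2 hle).symm

end Main

/-- Corollary 4.6. If the centre of `Aut(K)` has DCC on the compact
metrizable group `K`, then every ergodic finitely generated abelian group `Γ` of
continuous automorphisms of `K` contains an ergodic automorphism. -/
theorem statement15 {K : Type*} [Group K] [TopologicalSpace K] [IsTopologicalGroup K]
    [CompactSpace K] [TopologicalSpace.MetrizableSpace K]
    [MeasurableSpace K] [BorelSpace K]
    (μ : Measure K) [μ.IsHaarMeasure] [IsProbabilityMeasure μ]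
    (hdcc : HasDCC {β : ↥(ContAut K) | ∀ γ : ↥(ContAut K), β * γ = γ * β}) :
    ∀ {n : ℕ} (α : Fin n → ↥(ContAut K)), (∀ i j, α i * α j = α j * α i) →
      ∀ Γ : Subgroup ↥(ContAut K), Γ = Subgroup.closure (Set.range α) →
      ErgSet μ (Γ : Set ↥(ContAut K)) → ∃ a ∈ Γ, ErgAut μ a := by
  rintro n α hcomm Γ rfl herg
  have hmul : IsMulCommutative ↥(Subgroup.closure (range α)) :=
    Subgroup.isMulCommutative_closure (by
      rintro _ ⟨i, rfl⟩ _ ⟨j, rfl⟩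
      exact hcomm i j)
  let _ : CommGroup ↥(Subgroup.closure (range α)) := { mul_comm := hmul.is_comm.comm }
  have : Group.FG ↥(Subgroup.closure (range α)) := Group.closure_finite_fg _
  obtain ⟨g, hg⟩ := exists_ergAut_of_ergSet_range μ hdcc (Subgroup.closure (range α)).subtype
    (by rwa [Subgroup.range_subtype])
  exact ⟨g, g.2, hg⟩

end ErgZd
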